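/- Let a ∈ ℝ² with a ≠ 0, let c ∈ ℝ, τ > 0, and ũ ∈ ℝ². Define g : ℝ² → ℝ by g(u) = (1/2)‖u − ũ‖² + τ·|c + ⟨a, u⟩|. Then g has a unique minimizer u* over ℝ², given by: u* = ũ + τ·a if c + ⟨a, ũ⟩ < −τ‖a‖²; u* = ũ − τ·a if c + ⟨a, ũ⟩ > τ‖a‖²; and u* = ũ − ((c + ⟨a, ũ⟩)/‖a‖²)·a otherwise. -/

import Mathlib

open scoped RealInnerProductSpace

/-- If `s` is a subgradient of `τ|·|` at `c + ⟪a, v - s • a⟫`, then `v - s • a` is the unique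
minimizer of `u ↦ (1/2)‖u - v‖² + τ|c + ⟪a, u⟫|`. -/
theorem sub_smul_strict_minimizer {E : Type*} [NormedAddCommGroup E] [InnerProductSpace ℝ E]
    {a v w u : E} {c τ s : ℝ} (hs : |s| ≤ τ) (hw : w = v - s • a)
    (hsub : τ * |c + ⟪a, w⟫| = s * (c + ⟪a, w⟫)) (hu : u ≠ w) :
    (1 / 2) * ‖w - v‖ ^ 2 + τ * |c + ⟪a, w⟫| < (1 / 2) * ‖u - v‖ ^ 2 + τ * |c + ⟪a, u⟫| := by
  have hpos : 0 < ‖u - w‖ ^ 2 := by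
    have := norm_pos_iff.2 (sub_ne_zero.2 hu)
    positivity
  have hwv : ‖w - v‖ ^ 2 = ‖s • a‖ ^ 2 := by
    rw [hw, sub_sub_cancel_left, norm_neg]
  have huv : ‖u - v‖ ^ 2 = ‖u - w‖ ^ 2 - 2 * (s * (⟪a, u⟫ - ⟪a, w⟫)) + ‖s • a‖ ^ 2 := by
    have h : u - v = (u - w) - s • a := by rw [hw]; abel
    rw [h, norm_sub_sq_real, inner_smul_right, real_inner_comm, inner_sub_right]
  have hle : s * (c + ⟪a, u⟫) ≤ τ * |c + ⟪a, u⟫| :=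
    calc s * (c + ⟪a, u⟫) ≤ |s| * |c + ⟪a, u⟫| := by
          rw [← abs_mul]; exact le_abs_self _
      _ ≤ τ * |c + ⟪a, u⟫| := by gcongr
  rw [hsub, hwv, huv]
  linarith

/-- Soft-thresholding formula for the primal update of the Chambolle–Pock
algorithm for the `L¹` optical flow data term: the function
`g(u) = (1/2)‖u − ũ‖² + τ|c + ⟨a, u⟩|` on `ℝ²` has the explicit unique minimizer
given by the three-case formula. -/
theorem soft_threshold_unique_minimizer
    (a : EuclideanSpace ℝ (Fin 2)) (ha : a ≠ 0) (c τ : ℝ) (hτ : 0 < τ)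
    (util : EuclideanSpace ℝ (Fin 2)) :
    ∀ ustar : EuclideanSpace ℝ (Fin 2),
      ustar = (if c + ⟪a, util⟫ < -(τ * ‖a‖ ^ 2) then util + τ • a
        else if τ * ‖a‖ ^ 2 < c + ⟪a, util⟫ then util - τ • a
        else util - ((c + ⟪a, util⟫) / ‖a‖ ^ 2) • a) →
      ∀ u : EuclideanSpace ℝ (Fin 2), u ≠ ustar →
        (1 / 2) * ‖ustar - util‖ ^ 2 + τ * |c + ⟪a, ustar⟫|
          < (1 / 2) * ‖u - util‖ ^ 2 + τ * |c + ⟪a, u⟫| := by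
  intro ustar hustar u hu
  have hnorm : 0 < ‖a‖ ^ 2 := by
    have := norm_pos_iff.2 ha
    positivity
  have hinner (s : ℝ) : ⟪a, util - s • a⟫ = ⟪a, util⟫ - s * ‖a‖ ^ 2 := by
    rw [inner_sub_right, inner_smul_right, real_inner_self_eq_norm_sq]
  split_ifs at hustar with hneg hgt
  · have hw : ustar = util - (-τ) • a := by rw [hustar, neg_smul, sub_neg_eq_add]
    refine sub_smul_strict_minimizer (by rw [abs_neg, abs_of_pos hτ]) hw ?_ hu
    rw [hw, hinner, abs_of_neg (by linarith)]
    ring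
  · refine sub_smul_strict_minimizer (abs_of_pos hτ).le hustar ?_ hu
    rw [hustar, hinner, abs_of_pos (by linarith)]
  · refine sub_smul_strict_minimizer ?_ hustar ?_ hu
    · rw [abs_div, abs_of_pos hnorm, div_le_iff₀ hnorm, abs_le]
      exact ⟨not_lt.1 hneg, not_lt.1 hgt⟩
    · have hzero : c + ⟪a, ustar⟫ = 0 := by
        rw [hustar, hinner, div_mul_cancel₀ _ hnorm.ne']
        ring
      rw [hzero, abs_zero, mul_zero, mul_zero]
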